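/- Let (Ω, 𝒜, μ, T) be an aperiodic dynamical system on a standard Borel probability space. For every n ≥ 1 and every ε > 0 there exists a measurable set F ∈ 𝒜 such that the sets F, TF, …, T^{n−1}F are pairwise disjoint, μ(Ω \ ⋃_{i=0}^{n−1} TⁱF) < ε, and for μ-almost every x in the junk set J := Ω \ ⋃_{i=0}^{n−1} TⁱF one has Tx ∈ F. -/

import Mathlib

open MeasureTheory Filter Topology Set

/-- The first level of the `k`-th block when a column of height `r` is cut into `r / n` blocks, the
first `r % n` of height `n + 1` and the others of height `n`. -/
def blockStart (n r k : ℕ) : ℕ := k * n + min k (r % n)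

lemma blockStart_zero (n r : ℕ) : blockStart n r 0 = 0 := by simp [blockStart]

lemma blockStart_add_le_succ (n r k : ℕ) : blockStart n r k + n ≤ blockStart n r (k + 1) := by
  simp only [blockStart, add_mul, one_mul]
  omega

lemma blockStart_monotone (n r : ℕ) : Monotone (blockStart n r) :=
  monotone_nat_of_le_succ fun k ↦ by
    have := blockStart_add_le_succ n r k
    omega

lemma blockStart_add_le {n r k l : ℕ} (h : k < l) : blockStart n r k + n ≤ blockStart n r l :=
  (blockStart_add_le_succ n r k).trans (blockStart_monotone n r h)

lemma mod_lt_div_of_sq_le {n r : ℕ} (hn : 1 ≤ n) (hr : n * n ≤ r) : r % n < r / n :=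
  (Nat.mod_lt r hn).trans_le ((Nat.le_div_iff_mul_le hn).2 hr)

lemma blockStart_div {n r : ℕ} (hn : 1 ≤ n) (hr : n * n ≤ r) : blockStart n r (r / n) = r := by
  rw [blockStart, min_eq_right (mod_lt_div_of_sq_le hn hr).le]
  exact Nat.div_add_mod' r n

/-- Every level of a column either lies among the first `n` levels of a block, or is the extra top
level of a long block and lies directly below the next block. -/
lemma exists_blockStart_le_or_succ_eq {n r p : ℕ} (hn : 1 ≤ n) (hr : n * n ≤ r) (hp : p < r) :
    (∃ k < r / n, blockStart n r k ≤ p ∧ p < blockStart n r k + n) ∨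
      ∃ k < n, p = k * (n + 1) + n ∧ k + 1 < r / n ∧ p + 1 = blockStart n r (k + 1) := by
  have hex : ∃ k, p < blockStart n r k := ⟨r / n, by rwa [blockStart_div hn hr]⟩
  obtain ⟨k, hk, hmin⟩ : ∃ k, p < blockStart n r k ∧ ∀ l < k, blockStart n r l ≤ p := by
    classical
    exact ⟨Nat.find hex, Nat.find_spec hex, fun l hl ↦ not_lt.1 (Nat.find_min hex hl)⟩
  obtain _ | k := k
  · simp [blockStart_zero] at hk
  have hkp := hmin k k.lt_succ_self
  have hkq : k < r / n := by
    by_contra! h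
    have := blockStart_monotone n r h
    rw [blockStart_div hn hr] at this
    omega
  have hs := mod_lt_div_of_sq_le hn hr
  have hsn := Nat.mod_lt r hn
  by_cases hlt : p < blockStart n r k + n
  · exact Or.inl ⟨k, hkq, hkp, hlt⟩
  · simp only [blockStart, add_mul, one_mul] at *
    refine Or.inr ⟨k, by omega, ?_, by omega, by omega⟩
    rw [mul_add, mul_one]
    omega

section Iterates

variable {Ω : Type*} {T : Ω → Ω}

/-- The points of `A` whose first return time to `A` under `T` is `r`. -/
def firstReturnSet (T : Ω → Ω) (A : Set Ω) (r : ℕ) : Set Ω :=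
  {x | x ∈ A ∧ 1 ≤ r ∧ T^[r] x ∈ A ∧ ∀ k < r, 1 ≤ k → T^[k] x ∉ A}

lemma firstReturnSet_level_unique (hT : Function.Injective T) {A : Set Ω} {a b : Ω} {r s p q : ℕ}
    (ha : a ∈ firstReturnSet T A r) (hb : b ∈ firstReturnSet T A s) (hp : p < r) (hq : q < s)
    (h : T^[p] a = T^[q] b) : p = q ∧ r = s := by
  have key : ∀ {a b : Ω} {r s p q : ℕ}, a ∈ firstReturnSet T A r → b ∈ firstReturnSet T A s →
      p < r → q < s → T^[p] a = T^[q] b → p ≤ q := by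
    intro a b r s p q ha hb hp hq h
    by_contra! hlt
    rw [← Nat.add_sub_cancel' hlt.le, Function.iterate_add_apply] at h
    refine ha.2.2.2 (p - q) (by omega) (by omega) ?_
    rw [hT.iterate q h]
    exact hb.1
  have hpq : p = q := le_antisymm (key ha hb hp hq h) (key hb ha hq hp h.symm)
  subst hpq
  obtain rfl := hT.iterate p h
  refine ⟨rfl, le_antisymm ?_ ?_⟩
  · by_contra! hlt
    exact ha.2.2.2 s hlt hb.2.1 hb.2.2.1
  · by_contra! hlt
    exact hb.2.2.2 r hlt ha.2.1 ha.2.2.1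

/-- A point whose orbit visits `A` both in the past and in the future lies in a column over `A`. -/
lemma exists_firstReturnSet_level {A : Set Ω} {x : Ω} (hpast : ∃ p, ∃ a ∈ A, T^[p] a = x)
    (hfut : ∃ q, 1 ≤ q ∧ T^[q] x ∈ A) :
    ∃ r, ∃ p < r, ∃ a ∈ firstReturnSet T A r, T^[p] a = x := by
  classical
  obtain ⟨a, ha, hax⟩ := Nat.find_spec hpast
  have hpmin := fun m ↦ Nat.find_min hpast (m := m)
  obtain ⟨hq, hqx⟩ := Nat.find_spec hfut
  have hqmin := fun m ↦ Nat.find_min hfut (m := m)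
  generalize Nat.find hpast = p at *
  generalize Nat.find hfut = q at *
  refine ⟨q + p, p, by omega, a, ⟨ha, by omega, ?_, fun k hk hk1 hkA ↦ ?_⟩, hax⟩
  · rwa [Function.iterate_add_apply, hax]
  · rcases le_or_gt k p with hkp | hkp
    · refine hpmin (p - k) (by omega) ⟨_, hkA, ?_⟩
      rw [← Function.iterate_add_apply, Nat.sub_add_cancel hkp, hax]
    · refine hqmin (k - p) (by omega) ⟨by omega, ?_⟩
      rwa [← hax, ← Function.iterate_add_apply, Nat.sub_add_cancel hkp.le]

lemma iterate_image_disjoint (hT : Function.Injective T) {A : Set Ω} {n : ℕ}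
    (hA : ∀ x ∈ A, ∀ k, 1 ≤ k → k < n → T^[k] x ∉ A) :
    ∀ i < n, ∀ j < n, i ≠ j → Disjoint (T^[i] '' A) (T^[j] '' A) := by
  have key : ∀ i j, i < j → j < n → Disjoint (T^[i] '' A) (T^[j] '' A) := by
    intro i j hij hj
    rw [Set.disjoint_left]
    rintro _ ⟨a, ha, rfl⟩ ⟨b, hb, h⟩
    rw [← Nat.add_sub_cancel' hij.le, Function.iterate_add_apply] at h
    refine hA b hb (j - i) (by omega) (by omega) ?_
    rwa [hT.iterate i h]
  intro i hi j hj hij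
  rcases lt_or_gt_of_ne hij with h | h
  · exact key i j h hj
  · exact (key j i h hi).symm

/-- The union of the bottom levels of all the blocks, after cutting every column over `A` into
blocks of heights `n` and `n + 1`. -/
def towerBase (T : Ω → Ω) (A : Set Ω) (n : ℕ) : Set Ω :=
  ⋃ (r : ℕ) (k : ℕ) (_ : k < r / n), T^[blockStart n r k] '' firstReturnSet T A r

lemma mem_towerBase {A : Set Ω} {n : ℕ} {x : Ω} :
    x ∈ towerBase T A n ↔
      ∃ r, ∃ k < r / n, ∃ a ∈ firstReturnSet T A r, T^[blockStart n r k] a = x := by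
  simp [towerBase]

variable {A : Set Ω} {n M : ℕ}

lemma le_of_mem_firstReturnSet (hA : ∀ x ∈ A, ∀ k, 1 ≤ k → k < M → T^[k] x ∉ A)
    {r : ℕ} {a : Ω} (ha : a ∈ firstReturnSet T A r) : M ≤ r := by
  by_contra! h
  exact hA a ha.1 r ha.2.1 h ha.2.2.1

lemma towerBase_iterate_notMem (hT : Function.Injective T) (hn : 1 ≤ n) (hM : n * n ≤ M)
    (hA : ∀ x ∈ A, ∀ k, 1 ≤ k → k < M → T^[k] x ∉ A) :
    ∀ x ∈ towerBase T A n, ∀ k, 1 ≤ k → k < n → T^[k] x ∉ towerBase T A n := by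
  intro x hx j hj hjn hxj
  obtain ⟨r, k, hk, a, ha, rfl⟩ := mem_towerBase.1 hx
  obtain ⟨s, l, hl, b, hb, h⟩ := mem_towerBase.1 hxj
  have hr := blockStart_div hn (hM.trans (le_of_mem_firstReturnSet hA ha))
  have hs := blockStart_div hn (hM.trans (le_of_mem_firstReturnSet hA hb))
  have hkr := blockStart_add_le (n := n) (r := r) hk
  have hls := blockStart_add_le (n := n) (r := s) hl
  rw [← Function.iterate_add_apply] at h
  obtain ⟨h1, rfl⟩ := firstReturnSet_level_unique hT hb ha (by omega) (by omega) h
  rcases lt_trichotomy k l with hkl | rfl | hkl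
  · have := blockStart_add_le (n := n) (r := s) hkl
    omega
  · omega
  · have := blockStart_add_le (n := n) (r := s) hkl
    omega

/-- A point of a column over `A` outside the tower over `towerBase T A n` lies on one of finitely
many levels, and its image lies in the base. -/
lemma mem_and_apply_mem_of_notMem_tower (hn : 1 ≤ n) (hM : n * n ≤ M)
    (hA : ∀ x ∈ A, ∀ k, 1 ≤ k → k < M → T^[k] x ∉ A) {x : Ω}
    (hx : ∃ r, ∃ p < r, ∃ a ∈ firstReturnSet T A r, T^[p] a = x)
    (hxt : x ∈ (⋃ i ∈ Finset.range n, T^[i] '' towerBase T A n)ᶜ) :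
    x ∈ (⋃ k ∈ Finset.range n, T^[k * (n + 1) + n] '' A) ∧ T x ∈ towerBase T A n := by
  obtain ⟨r, p, hp, a, ha, rfl⟩ := hx
  rcases exists_blockStart_le_or_succ_eq hn (hM.trans (le_of_mem_firstReturnSet hA ha)) hp with
    ⟨k, hk, hkp, hpk⟩ | ⟨k, hk, hpk, hkq, hps⟩
  · refine absurd ?_ hxt
    refine Set.mem_biUnion (x := p - blockStart n r k)
      (Finset.mem_coe.2 (Finset.mem_range.2 (by omega))) ?_
    refine ⟨T^[blockStart n r k] a, mem_towerBase.2 ⟨r, k, hk, a, ha, rfl⟩, ?_⟩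
    rw [← Function.iterate_add_apply, Nat.sub_add_cancel hkp]
  · refine ⟨Set.mem_biUnion (Finset.mem_coe.2 (Finset.mem_range.2 hk)) ⟨a, ha.1, by rw [hpk]⟩, ?_⟩
    refine mem_towerBase.2 ⟨r, k + 1, hkq, a, ha, ?_⟩
    rw [← hps, Function.iterate_succ_apply']

/-- Greedy union of the sets `C i`: at each step, add the points of `C i` whose orbit does not meet
the set built so far at times of absolute value less than `M`. -/
def greedyUnion (T : Ω → Ω) (C : ℕ → Set Ω) (M : ℕ) : ℕ → Set Ω
  | 0 => ∅
  | i + 1 => greedyUnion T C M i ∪ (C i \ ⋃ k ∈ Finset.range M,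
      (T^[k] '' greedyUnion T C M i ∪ T^[k] ⁻¹' greedyUnion T C M i))

lemma greedyUnion_iterate_notMem {C : ℕ → Set Ω}
    (hC : ∀ i, ∀ x ∈ C i, ∀ k, 1 ≤ k → k < M → T^[k] x ∉ C i) (i : ℕ) :
    ∀ x ∈ greedyUnion T C M i, ∀ k, 1 ≤ k → k < M → T^[k] x ∉ greedyUnion T C M i := by
  induction i with
  | zero => simp [greedyUnion]
  | succ i ih =>
    rintro x (hx | ⟨hx, hx'⟩) k hk hkM (hy | ⟨hy, hy'⟩)
    · exact ih x hx k hk hkM hy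
    · exact hy' (Set.mem_biUnion (Finset.mem_coe.2 (Finset.mem_range.2 hkM))
        (Or.inl ⟨x, hx, rfl⟩))
    · exact hx' (Set.mem_biUnion (Finset.mem_coe.2 (Finset.mem_range.2 hkM)) (Or.inr hy))
    · exact hC i x hx k hk hkM hy

lemma greedyUnion_monotone (C : ℕ → Set Ω) : Monotone (greedyUnion T C M) :=
  monotone_nat_of_le_succ fun _ ↦ Set.subset_union_left

lemma exists_iterate_mem_greedyUnion (hM : 1 ≤ M) {C : ℕ → Set Ω} {i : ℕ} {x : Ω} (hx : x ∈ C i) :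
    ∃ k < M, T^[k] x ∈ greedyUnion T C M (i + 1) ∨
      ∃ a ∈ greedyUnion T C M (i + 1), T^[k] a = x := by
  by_cases h : x ∈ ⋃ k ∈ Finset.range M,
      (T^[k] '' greedyUnion T C M i ∪ T^[k] ⁻¹' greedyUnion T C M i)
  · simp only [Set.mem_iUnion, Finset.mem_range] at h
    obtain ⟨k, hk, ⟨a, ha, rfl⟩ | h⟩ := h
    · exact ⟨k, hk, Or.inr ⟨a, Or.inl ha, rfl⟩⟩
    · exact ⟨k, hk, Or.inl (Or.inl h)⟩
  · exact ⟨0, hM, Or.inl (Or.inr ⟨hx, h⟩)⟩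

end Iterates

section Measurable

variable {Ω : Type*} [MeasurableSpace Ω] {T : Ω → Ω}

lemma MeasurableEmbedding.iterate (hT : MeasurableEmbedding T) (k : ℕ) :
    MeasurableEmbedding T^[k] := by
  induction k with
  | zero => exact MeasurableEmbedding.id
  | succ k ih => exact ih.comp hT

lemma measurableSet_firstReturnSet (hT : Measurable T) {A : Set Ω} (hA : MeasurableSet A) (r : ℕ) :
    MeasurableSet (firstReturnSet T A r) := by
  have h : ∀ k, MeasurableSet {x | T^[k] x ∈ A} := fun k ↦ hT.iterate k hA
  refine hA.inter ((MeasurableSet.const _).inter ((h r).inter ?_))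
  change MeasurableSet {x | ∀ k < r, 1 ≤ k → T^[k] x ∉ A}
  simp only [Set.ofPred_forall]
  exact .iInter fun k ↦ .iInter fun _ ↦ .iInter fun _ ↦ (h k).compl

lemma measurableSet_towerBase (hT : MeasurableEmbedding T) {A : Set Ω} (hA : MeasurableSet A)
    (n : ℕ) : MeasurableSet (towerBase T A n) :=
  .iUnion fun r ↦ .iUnion fun _ ↦ .iUnion fun _ ↦
    (hT.iterate _).measurableSet_image.2 (measurableSet_firstReturnSet hT.measurable hA r)

lemma measurableSet_greedyUnion (hT : MeasurableEmbedding T) {C : ℕ → Set Ω}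
    (hC : ∀ i, MeasurableSet (C i)) (M i : ℕ) : MeasurableSet (greedyUnion T C M i) := by
  induction i with
  | zero => exact .empty
  | succ i ih =>
    exact ih.union ((hC i).diff (.biUnion (Finset.range M).countable_toSet fun k _ ↦
      ((hT.iterate k).measurableSet_image.2 ih).union (hT.measurable.iterate k ih)))

/-- Countably many measurable sets, each disjoint from its first `M - 1` preimages, cover the points
having no period less than `M`. -/
lemma exists_measurableSet_cover_of_iterate_ne [StandardBorelSpace Ω] (hT : Measurable T) (M : ℕ) :
    ∃ C : ℕ → Set Ω, (∀ i, MeasurableSet (C i)) ∧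
      (∀ i, ∀ x ∈ C i, ∀ k, 1 ≤ k → k < M → T^[k] x ∉ C i) ∧
      ∀ x, (∀ k, 1 ≤ k → T^[k] x ≠ x) → ∃ i, x ∈ C i := by
  obtain ⟨f, hf⟩ := MeasureTheory.exists_measurableEmbedding_real Ω
  obtain ⟨b, hbc, -, hb⟩ := TopologicalSpace.exists_countable_basis ℝ
  have hbne : b.Nonempty := by
    obtain ⟨u, hu, -⟩ := hb.exists_subset_of_mem_open (Set.mem_univ (0 : ℝ)) isOpen_univ
    exact ⟨u, hu⟩
  obtain ⟨u, rfl⟩ := hbc.exists_eq_range hbne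
  have hu : ∀ i, MeasurableSet (u i) := fun i ↦ (hb.isOpen (Set.mem_range_self i)).measurableSet
  refine ⟨fun i ↦ f ⁻¹' u i ∩ {x | ∀ k, 1 ≤ k → k < M → f (T^[k] x) ∉ u i}, fun i ↦ ?_, ?_, ?_⟩
  · refine (hf.measurable (hu i)).inter ?_
    simp only [Set.ofPred_forall]
    exact .iInter fun k ↦ .iInter fun _ ↦ .iInter fun _ ↦
      ((hf.measurable.comp (hT.iterate k)) (hu i)).compl
  · exact fun i x hx k hk hkM hkx ↦ hx.2 k hk hkM hkx.1
  · intro x hx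
    have hfin : (((fun k ↦ f (T^[k] x)) '' Set.Ico 1 M)).Finite := (Set.finite_Ico 1 M).image _
    obtain ⟨_, ⟨i, rfl⟩, hxi, hsub⟩ := hb.exists_subset_of_mem_open
      (a := f x) (u := ((fun k ↦ f (T^[k] x)) '' Set.Ico 1 M)ᶜ)
      (by rintro ⟨k, hk, h⟩; exact hx k hk.1 (hf.injective h)) hfin.isClosed.isOpen_compl
    exact ⟨i, hxi, fun k hk hkM hkx ↦ hsub hkx ⟨k, ⟨hk, hkM⟩, rfl⟩⟩

variable {μ : Measure Ω}

lemma measure_iterate_image (hT : MeasurableEmbedding T) (hμ : MeasurePreserving T μ μ) (k : ℕ)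
    (A : Set Ω) : μ (T^[k] '' A) = μ A := by
  rw [← (hμ.iterate k).measure_preimage_emb (hT.iterate k),
    Set.preimage_image_eq _ (hT.injective.iterate k)]

/-- In an aperiodic system there is a measurable set that is disjoint from its first `M - 1`
preimages and is visited by almost every orbit in the past and in the future. -/
lemma exists_sweeping_measurableSet [StandardBorelSpace Ω] (hT : MeasurableEmbedding T)
    (hsurj : Function.Surjective T) (hμ : MeasurePreserving T μ μ)
    (haper : μ {x | ∃ n ≥ 1, T^[n] x = x} = 0) {M : ℕ} (hM : 1 ≤ M) :
    ∃ A : Set Ω, MeasurableSet A ∧ (∀ x ∈ A, ∀ k, 1 ≤ k → k < M → T^[k] x ∉ A) ∧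
      ∀ᵐ x ∂μ, (∃ p, ∃ a ∈ A, T^[p] a = x) ∧ ∃ q, 1 ≤ q ∧ T^[q] x ∈ A := by
  obtain ⟨C, hCm, hCd, hC⟩ := exists_measurableSet_cover_of_iterate_ne hT.measurable M
  set A : Set Ω := ⋃ i, greedyUnion T C M i with hA
  refine ⟨A, .iUnion fun i ↦ measurableSet_greedyUnion hT hCm M i, ?_, ?_⟩
  · intro x hx k hk hkM hkx
    obtain ⟨i, hi⟩ := Set.mem_iUnion.1 hx
    obtain ⟨j, hj⟩ := Set.mem_iUnion.1 hkx
    exact greedyUnion_iterate_notMem hCd (max i j) x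
      (greedyUnion_monotone C (le_max_left i j) hi) k hk hkM
      (greedyUnion_monotone C (le_max_right i j) hj)
  · have hvisit : ∀ᵐ x ∂μ, ∃ k < M, T^[k] x ∈ A ∨ ∃ a ∈ A, T^[k] a = x := by
      have hae : ∀ᵐ x ∂μ, ¬ ∃ n ≥ 1, T^[n] x = x := by
        rw [ae_iff]
        simpa using haper
      filter_upwards [hae] with x hx
      obtain ⟨i, hi⟩ := hC x fun k hk h ↦ hx ⟨k, hk, h⟩
      have hsub : greedyUnion T C M (i + 1) ⊆ A := Set.subset_iUnion (greedyUnion T C M) (i + 1)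
      obtain ⟨k, hk, h | ⟨a, ha, h⟩⟩ := exists_iterate_mem_greedyUnion hM (T := T) hi
      · exact ⟨k, hk, Or.inl (hsub h)⟩
      · exact ⟨k, hk, Or.inr ⟨a, hsub ha, h⟩⟩
    have hfut := (hμ.iterate M).quasiMeasurePreserving.ae hvisit
    have hpast : ∀ᵐ x ∂μ, ∃ y, T^[M] y = x ∧ ∃ k < M, T^[k] y ∈ A ∨ ∃ a ∈ A, T^[k] a = y := by
      rw [ae_iff] at hvisit ⊢
      rw [← measure_iterate_image hT hμ M] at hvisit
      refine measure_mono_null (fun x hx ↦ ?_) hvisit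
      obtain ⟨y, rfl⟩ := hsurj.iterate M x
      exact ⟨y, fun h ↦ hx ⟨y, rfl, h⟩, rfl⟩
    filter_upwards [hfut, hpast] with x hx hx'
    constructor
    · obtain ⟨y, rfl, k, hk, h | ⟨a, ha, rfl⟩⟩ := hx'
      · refine ⟨M - k, _, h, ?_⟩
        rw [← Function.iterate_add_apply, Nat.sub_add_cancel hk.le]
      · exact ⟨M + k, a, ha, Function.iterate_add_apply _ _ _ _⟩
    · obtain ⟨k, hk, h | ⟨a, ha, h⟩⟩ := hx
      · refine ⟨k + M, by omega, ?_⟩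
        rwa [Function.iterate_add_apply]
      · refine ⟨M - k, by omega, ?_⟩
        rw [← Nat.add_sub_cancel' hk.le, Function.iterate_add_apply] at h
        rwa [← hT.injective.iterate k h]

lemma natCast_mul_measure_le_one [IsProbabilityMeasure μ] (hT : MeasurableEmbedding T)
    (hμ : MeasurePreserving T μ μ) {A : Set Ω} (hAm : MeasurableSet A) {M : ℕ}
    (hA : ∀ x ∈ A, ∀ k, 1 ≤ k → k < M → T^[k] x ∉ A) : M * μ A ≤ 1 := by
  calc M * μ A = ∑ k ∈ Finset.range M, μ (T^[k] '' A) := by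
        simp [measure_iterate_image hT hμ]
    _ = μ (⋃ k ∈ Finset.range M, T^[k] '' A) := by
        refine (measure_biUnion_finset ?_ fun k _ ↦ (hT.iterate k).measurableSet_image.2 hAm).symm
        intro i hi j hj hij
        exact iterate_image_disjoint hT.injective hA i (by simpa using hi) j (by simpa using hj) hij
    _ ≤ 1 := prob_le_one

end Measurable

/-- Rokhlin lemma with junk set of sojourn time one. In every aperiodic
dynamical system on a standard Borel probability space, for every `n ≥ 1` and `ε > 0`
there is a measurable set `F` whose images `F, T F, …, T^(n-1) F` are pairwise disjoint,
cover `Ω` up to measure `< ε`, and such that almost every point of the leftover "junk"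
set is sent into `F` by `T`. -/
theorem rokhlin_tower_with_sojourn_one
    {Ω : Type*} [MeasurableSpace Ω] [StandardBorelSpace Ω]
    (μ : Measure Ω) [IsProbabilityMeasure μ]
    (T : Ω → Ω) (hT : MeasurePreserving T μ μ) (hTbij : Function.Bijective T)
    (haper : μ {x | ∃ n ≥ 1, T^[n] x = x} = 0)
    (n : ℕ) (hn : 1 ≤ n) (ε : ℝ) (hε : 0 < ε) :
    ∃ F : Set Ω, MeasurableSet F ∧
      (∀ i < n, ∀ j < n, i ≠ j → Disjoint (T^[i] '' F) (T^[j] '' F)) ∧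
      μ ((⋃ i ∈ Finset.range n, T^[i] '' F)ᶜ) < ENNReal.ofReal ε ∧
      ∀ᵐ x ∂μ, x ∈ (⋃ i ∈ Finset.range n, T^[i] '' F)ᶜ → T x ∈ F := by
  have hTe : MeasurableEmbedding T := hT.measurable.measurableEmbedding hTbij.injective
  obtain ⟨N, hN⟩ := exists_nat_gt (n / ε)
  set M := max N (n * n) with hMdef
  have hnM : n * n ≤ M := le_max_right _ _
  have hM : 1 ≤ M := (Nat.mul_pos hn hn).trans_le hnM
  have hnε : (n : ℝ) < ε * M := by
    rw [← div_lt_iff₀' hε]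
    exact hN.trans_le (by exact_mod_cast le_max_left _ _)
  obtain ⟨A, hAm, hA, hsweep⟩ := exists_sweeping_measurableSet hTe hTbij.surjective hT haper hM
  have hjunk : ∀ᵐ x ∂μ, x ∈ (⋃ i ∈ Finset.range n, T^[i] '' towerBase T A n)ᶜ →
      x ∈ (⋃ k ∈ Finset.range n, T^[k * (n + 1) + n] '' A) ∧ T x ∈ towerBase T A n := by
    filter_upwards [hsweep] with x hx hxt
    exact mem_and_apply_mem_of_notMem_tower hn hnM hA (exists_firstReturnSet_level hx.1 hx.2) hxt
  refine ⟨towerBase T A n, measurableSet_towerBase hTe hAm n,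
    iterate_image_disjoint hTbij.injective (towerBase_iterate_notMem hTbij.injective hn hnM hA),
    ?_, hjunk.mono fun x hx hxt ↦ (hx hxt).2⟩
  have hμA : (M : ℝ) * μ.real A ≤ 1 := by
    have h := ENNReal.toReal_mono ENNReal.one_ne_top (natCast_mul_measure_le_one hTe hT hAm hA)
    simpa [Measure.real] using h
  have hle : μ ((⋃ i ∈ Finset.range n, T^[i] '' towerBase T A n)ᶜ) ≤ n * μ A :=
    calc _ ≤ μ (⋃ k ∈ Finset.range n, T^[k * (n + 1) + n] '' A) :=
          measure_mono_ae (hjunk.mono fun x hx hxt ↦ (hx hxt).1)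
      _ ≤ ∑ k ∈ Finset.range n, μ (T^[k * (n + 1) + n] '' A) := measure_biUnion_finset_le _ _
      _ = n * μ A := by simp [measure_iterate_image hTe hT]
  refine hle.trans_lt ?_
  rw [← ofReal_measureReal (μ := μ) (s := A), ← ENNReal.ofReal_natCast,
    ← ENNReal.ofReal_mul (by positivity), ENNReal.ofReal_lt_ofReal_iff hε]
  have hM0 : (0 : ℝ) < M := by exact_mod_cast hM
  have hA0 : 0 ≤ μ.real A := measureReal_nonneg
  rcases hA0.eq_or_lt with h0 | h0
  · simpa [← h0] using hε
  · nlinarith
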